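/- arXiv:2410.08951 — 2 statements merged into one kernel-verified Lean document; each statement's English description precedes it below -/
import Mathlib

section
/- Under the stated hypotheses on Φ and f (a local diffeomorphism with triangular component structure, with X2 = x2·H, X4 = x4·G, conjugating Z''_{1,c} to f·(Z''_{1,c̃}∘Φ) modulo span{∂_{x5}, ∂_{y5}}), one necessarily has c = c̃. -/
noncomputable section

/-- The model space `ℝ^13` with coordinates
`(t, x0, y0, x1, y1, x2, y2, x3, y3, x4, y4, x5, y5)`
indexed by `0, 1, ..., 12` respectively. -/
abbrev E13 := Fin 13 → ℝ

/-- The constant coordinate vector field `∂_u` of the `i`-th coordinate. -/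
def e (i : Fin 13) : E13 := Pi.single i 1

/-- Partial derivative of a scalar function `F` in the `i`-th coordinate
direction, at a point `p`. -/
def pd (F : E13 → ℝ) (i : Fin 13) (p : E13) : ℝ := fderiv ℝ F p (e i)

/-- The vector field `Z''_{1,a}` of the EKR pseudo-normal form for the
singularity class 1.2.1.2.1 (at tangency points with the locus of 1.2.1.2):
`Z''_{1,a} = ∂_{x3} + (1 + y4)·∂_{y3} + x5·∂_{x4} + (a + y5)·∂_{y4}
 + x4·( ∂_{x1} + y2·∂_{y1} + (1 + x3)·∂_{x2} + y3·∂_{y2} + x2·( ∂_t + x1·∂_{x0} + y1·∂_{y0} ) )`. -/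
def Z (a : ℝ) (p : E13) : E13 :=
  e 7 + (1 + p 10) • e 8 + p 11 • e 9 + (a + p 12) • e 10 +
    p 9 • (e 3 + p 6 • e 4 + (1 + p 7) • e 5 + p 8 • e 6 +
      p 5 • (e 0 + p 3 • e 1 + p 4 • e 2))

open Filter Topology

/-- The part of `Z a` multiplied by `x4`. -/
def innerField (p : E13) : E13 :=
  e 3 + p 6 • e 4 + (1 + p 7) • e 5 + p 8 • e 6 + p 5 • (e 0 + p 3 • e 1 + p 4 • e 2)

/-- The part of `innerField` multiplied by `x2`. -/
def baseField (p : E13) : E13 := e 0 + p 3 • e 1 + p 4 • e 2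

/-- The component `F i` depends only on the coordinates of index at most `n`. -/
def DependsUpTo (F : E13 → E13) (i : Fin 13) (n : ℕ) : Prop :=
  ∀ p q : E13, (∀ k : Fin 13, (k : ℕ) ≤ n → p k = q k) → F p i = F q i

theorem Z_apply_of_le_six (a : ℝ) (p : E13) {k : Fin 13} (hk : (k : ℕ) ≤ 6) :
    Z a p k = p 9 * innerField p k := by
  revert hk
  fin_cases k <;> simp [Z, innerField, e]

theorem innerField_apply_of_le_two (p : E13) {k : Fin 13} (hk : (k : ℕ) ≤ 2) :
    innerField p k = p 5 * baseField p k := by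
  revert hk
  fin_cases k <;> simp [innerField, baseField, e]

theorem innerField_apply_of_le_four {p : E13} (h5 : p 5 = 0) (h6 : p 6 = 0) {k : Fin 13}
    (hk : (k : ℕ) ≤ 4) : innerField p k = e 3 k := by
  revert hk
  fin_cases k <;> simp [innerField, e, h5, h6]

theorem hasDerivAt_line {F : E13 → E13} {p : E13} (h : DifferentiableAt ℝ F p) (v : E13)
    (i : Fin 13) : HasDerivAt (fun s : ℝ => F (p + s • v) i) (fderiv ℝ F p v i) 0 := by
  have h1 : HasDerivAt (fun s : ℝ => p + s • v) v 0 := by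
    simpa using ((hasDerivAt_id (0 : ℝ)).smul_const v).const_add p
  have h2 : HasFDerivAt F (fderiv ℝ F p) (p + (0 : ℝ) • v) := by simpa using h.hasFDerivAt
  exact hasDerivAt_pi.1 (h2.comp_hasDerivAt 0 h1) i

theorem fderiv_apply_eq_of_line {F : E13 → E13} {p : E13} (h : DifferentiableAt ℝ F p) {v : E13}
    {i : Fin 13} {g : ℝ → ℝ} {m : ℝ} (hg : HasDerivAt g m 0)
    (hF : ∀ᶠ s in 𝓝 (0 : ℝ), F (p + s • v) i = g s) : fderiv ℝ F p v i = m :=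
  (hasDerivAt_line h v i).unique (hg.congr_of_eventuallyEq hF)

theorem DependsUpTo.fderiv_congr {F : E13 → E13} {i : Fin 13} {n : ℕ} (hd : DependsUpTo F i n)
    {p q v w : E13} (hp : DifferentiableAt ℝ F p) (hq : DifferentiableAt ℝ F q)
    (hpq : ∀ k : Fin 13, (k : ℕ) ≤ n → p k = q k) (hvw : ∀ k : Fin 13, (k : ℕ) ≤ n → v k = w k) :
    fderiv ℝ F p v i = fderiv ℝ F q w i :=
  fderiv_apply_eq_of_line hp (hasDerivAt_line hq w i) <| Eventually.of_forall fun s =>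
    hd _ _ fun k hk => by simp [hpq k hk, hvw k hk]

theorem eventually_line_mem {U : Set E13} (hU : IsOpen U) {p : E13} (hp : p ∈ U) (v : E13) :
    ∀ᶠ s in 𝓝 (0 : ℝ), p + s • v ∈ U := by
  have hc : ContinuousAt (fun s : ℝ => p + s • v) 0 := by fun_prop
  exact hc.eventually (by simpa using hU.mem_nhds hp)

theorem eqOn_of_coord_mul_eqOn {U : Set E13} (hU : IsOpen U) (j : Fin 13) {g h : E13 → ℝ}
    (hg : ContinuousOn g U) (hh : ContinuousOn h U) (hgh : ∀ p ∈ U, p j * g p = p j * h p) :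
    ∀ p ∈ U, g p = h p := by
  intro p hp
  by_cases hj : p j = 0
  · have hc : ContinuousAt (fun s : ℝ => p + s • e j) 0 := by fun_prop
    have hl : ∀ k : E13 → ℝ, ContinuousOn k U →
        Tendsto (fun s : ℝ => k (p + s • e j)) (𝓝[≠] 0) (𝓝 (k p)) := fun k hk => by
      have h1 : ContinuousAt k (p + (0 : ℝ) • e j) := by
        simpa using hk.continuousAt (hU.mem_nhds hp)
      have h2 := (ContinuousAt.comp (f := fun s : ℝ => p + s • e j) h1 hc).tendsto
      simp only [Function.comp_def, zero_smul, add_zero] at h2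
      exact h2.mono_left nhdsWithin_le_nhds
    refine tendsto_nhds_unique ((hl g hg).congr' ?_) (hl h hh)
    filter_upwards [nhdsWithin_le_nhds (eventually_line_mem hU hp (e j)),
      self_mem_nhdsWithin] with s hs hs0
    refine mul_left_cancel₀ ?_ (hgh _ hs)
    simpa [hj, e] using hs0
  · exact mul_left_cancel₀ hj (hgh p hp)

theorem apply_eq_zero_of_mem_span {v : E13} (hv : v ∈ Submodule.span ℝ ({e 11, e 12} : Set E13))
    {i : Fin 13} (hi : (i : ℕ) ≤ 10) : v i = 0 := by
  obtain ⟨a, b, rfl⟩ := Submodule.mem_span_pair.1 hv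
  have h11 : i ≠ 11 := by rintro rfl; simp at hi
  have h12 : i ≠ 12 := by rintro rfl; simp at hi
  simp [e, h11, h12]

/-- Under the stated hypotheses on `Φ` and `f`, necessarily `c = c'`. -/
theorem conjugation_forces_equal_parameters_12121 (c c' : ℝ)
    (Φ : E13 → E13) (U : Set E13) (hU : IsOpen U) (h0U : (0 : E13) ∈ U)
    (hΦsmooth : ContDiffOn ℝ (⊤ : ℕ∞) Φ U) (hΦ0 : Φ 0 = 0)
    (hdiffeo : Function.Bijective (fderiv ℝ Φ 0))
    -- the components `T, X0, Y0` (indices 0,1,2) depend only on `t, x0, y0`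
    (htri0 : ∀ p q : E13, (∀ k : Fin 13, (k : ℕ) ≤ 2 → p k = q k) →
      ∀ i : Fin 13, (i : ℕ) ≤ 2 → Φ p i = Φ q i)
    -- for `1 ≤ j ≤ 5`, the components `Xj, Yj` (indices 2j+1, 2j+2)
    -- depend only on `t, x0, y0, x1, y1, ..., xj, yj`
    (htri : ∀ j : ℕ, 1 ≤ j → j ≤ 5 → ∀ p q : E13,
      (∀ k : Fin 13, (k : ℕ) ≤ 2 * j + 2 → p k = q k) →
      ∀ i : Fin 13, ((i : ℕ) = 2 * j + 1 ∨ (i : ℕ) = 2 * j + 2) → Φ p i = Φ q i)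
    (H G : E13 → ℝ)
    (hHs : ContDiffOn ℝ (⊤ : ℕ∞) H U) (hGs : ContDiffOn ℝ (⊤ : ℕ∞) G U)
    (hH0 : H 0 ≠ 0) (hG0 : G 0 ≠ 0)
    -- `X2 = x2·H`, `X4 = x4·G`
    (hX2 : ∀ p ∈ U, Φ p 5 = p 5 * H p)
    (hX4 : ∀ p ∈ U, Φ p 9 = p 9 * G p)
    (f : E13 → ℝ) (hfs : ContDiffOn ℝ (⊤ : ℕ∞) f U) (hf0 : f 0 ≠ 0)
    -- `dΦ(p)·Z_{1,c}(p) − f(p)·Z_{1,c'}(Φ(p)) ∈ span{∂_{x5}, ∂_{y5}}` near 0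
    (hconj : ∀ p ∈ U, fderiv ℝ Φ p (Z c p) - f p • Z c' (Φ p) ∈
      Submodule.span ℝ ({e 11, e 12} : Set E13)) :
    c = c' := by
  have hdiff : ∀ p ∈ U, DifferentiableAt ℝ Φ p := fun p hp =>
    (hΦsmooth.contDiffAt (hU.mem_nhds hp)).differentiableAt (by simp)
  have hd0 := hdiff 0 h0U
  have hcΦ : ContinuousOn Φ U := hΦsmooth.continuousOn
  have hcd : ContinuousOn (fderiv ℝ Φ) U :=
    hΦsmooth.continuousOn_fderiv_of_isOpen hU (by simp)
  have hcf := hfs.continuousOn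
  have hcG := hGs.continuousOn
  have hcH := hHs.continuousOn
  have dep2 : ∀ i : Fin 13, (i : ℕ) ≤ 2 → DependsUpTo Φ i 2 := fun i hi p q h => htri0 p q h i hi
  have dep3 : DependsUpTo Φ 3 4 := fun p q h => htri 1 (by simp) (by simp) p q h 3 (by simp)
  have dep4 : DependsUpTo Φ 4 4 := fun p q h => htri 1 (by simp) (by simp) p q h 4 (by simp)
  have dep5 : DependsUpTo Φ 5 6 := fun p q h => htri 2 (by simp) (by simp) p q h 5 (by simp)
  have dep6 : DependsUpTo Φ 6 6 := fun p q h => htri 2 (by simp) (by simp) p q h 6 (by simp)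
  have hZ : ∀ p ∈ U, ∀ i : Fin 13, (i : ℕ) ≤ 10 →
      fderiv ℝ Φ p (Z c p) i = f p * Z c' (Φ p) i := fun p hp i hi => by
    simpa [sub_eq_zero] using apply_eq_zero_of_mem_span (hconj p hp) hi
  -- Division by `x4` and `x2`.
  have hcW : ContinuousOn (fun p => fderiv ℝ Φ p (innerField p)) U :=
    hcd.clm_apply (by unfold innerField; fun_prop)
  have hcB : ContinuousOn (fun p => fderiv ℝ Φ p (baseField p)) U :=
    hcd.clm_apply (by unfold baseField; fun_prop)
  have hinner : ∀ i : Fin 13, 3 ≤ (i : ℕ) → (i : ℕ) ≤ 6 → DependsUpTo Φ i 6 → ∀ p ∈ U,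
      fderiv ℝ Φ p (innerField p) i = f p * G p * innerField (Φ p) i := by
    intro i hi3 hi hdep
    have hcI : ContinuousOn (fun p => innerField (Φ p)) U := by
      have : Continuous innerField := by unfold innerField; fun_prop
      exact this.comp_continuousOn hcΦ
    refine eqOn_of_coord_mul_eqOn hU 9 (continuousOn_pi.1 hcW i)
      ((hcf.mul hcG).mul (continuousOn_pi.1 hcI i)) fun p hp => ?_
    have h1 : fderiv ℝ Φ p (Z c p) i = fderiv ℝ Φ p (p 9 • innerField p) i := by
      refine hdep.fderiv_congr (hdiff p hp) (hdiff p hp) (fun _ _ => rfl) fun k hk => ?_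
      simp [Z_apply_of_le_six c p hk]
    have h2 : Z c' (Φ p) i = Φ p 9 * innerField (Φ p) i := Z_apply_of_le_six c' (Φ p) hi
    rw [hZ p hp i (by omega), h2, hX4 p hp, map_smul] at h1
    simp only [Pi.smul_apply, smul_eq_mul] at h1
    linear_combination -h1
  have hbase : ∀ i : Fin 13, (i : ℕ) ≤ 2 → ∀ p ∈ U,
      fderiv ℝ Φ p (baseField p) i = f p * G p * H p * baseField (Φ p) i := by
    intro i hi
    have hcI : ContinuousOn (fun p => baseField (Φ p)) U := by
      have : Continuous baseField := by unfold baseField; fun_prop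
      exact this.comp_continuousOn hcΦ
    refine eqOn_of_coord_mul_eqOn hU 5 (continuousOn_pi.1 hcB i)
      (((hcf.mul hcG).mul hcH).mul (continuousOn_pi.1 hcI i)) ?_
    refine eqOn_of_coord_mul_eqOn hU 9
      ((continuous_apply 5).continuousOn.mul (continuousOn_pi.1 hcB i))
      ((continuous_apply 5).continuousOn.mul
        (((hcf.mul hcG).mul hcH).mul (continuousOn_pi.1 hcI i))) fun p hp => ?_
    have h1 : fderiv ℝ Φ p (Z c p) i = fderiv ℝ Φ p ((p 9 * p 5) • baseField p) i := by
      refine (dep2 i hi).fderiv_congr (hdiff p hp) (hdiff p hp) (fun _ _ => rfl) fun k hk => ?_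
      simp [Z_apply_of_le_six c p (show (k : ℕ) ≤ 6 by omega), innerField_apply_of_le_two p hk,
        mul_assoc]
    have h2 : Z c' (Φ p) i = Φ p 9 * Φ p 5 * baseField (Φ p) i := by
      rw [Z_apply_of_le_six c' _ (by omega), innerField_apply_of_le_two _ hi, mul_assoc]
    rw [hZ p hp i (by omega), h2, hX4 p hp, hX2 p hp, map_smul] at h1
    simp only [Pi.smul_apply, smul_eq_mul] at h1
    linear_combination -h1
  have dep3' : DependsUpTo Φ 3 6 := fun p q h => dep3 p q fun k hk => h k (by omega)
  have dep4' : DependsUpTo Φ 4 6 := fun p q h => dep4 p q fun k hk => h k (by omega)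
  have hΦ0' : ∀ i, Φ 0 i = 0 := fun i => by rw [hΦ0]; rfl
  have hmem : ∀ᶠ s in 𝓝 (0 : ℝ), s • e 3 ∈ U := by
    simpa using eventually_line_mem hU h0U (e 3)
  -- `Y1` vanishes along the `x1`-axis.
  have hY1x : fderiv ℝ Φ 0 (e 3) 4 = 0 := by
    have h1 := hinner 4 (by simp) (by simp) dep4' 0 h0U
    have h2 : fderiv ℝ Φ 0 (innerField 0) 4 = fderiv ℝ Φ 0 (e 3) 4 := by
      refine dep4.fderiv_congr hd0 hd0 (fun _ _ => rfl) fun k hk => ?_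
      exact innerField_apply_of_le_four rfl rfl hk
    rw [← h2, h1]
    simp [innerField, e, hΦ0']
  have hbase0 : ∀ i : Fin 13, (i : ℕ) ≤ 2 → ∀ s : ℝ, s • e 3 ∈ U →
      fderiv ℝ Φ (s • e 3) (baseField (s • e 3)) i =
        fderiv ℝ Φ 0 (e 0) i + s * fderiv ℝ Φ 0 (e 1) i := by
    intro i hi s hs
    have h1 : fderiv ℝ Φ (s • e 3) (baseField (s • e 3)) i = fderiv ℝ Φ 0 (e 0 + s • e 1) i := by
      refine (dep2 i hi).fderiv_congr (hdiff _ hs) hd0 (fun k hk => ?_) fun k hk => ?_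
      · have : k ≠ 3 := by rintro rfl; simp at hk
        simp [e, this]
      · simp [baseField, e]
    simpa using h1
  have hrel : ∀ s : ℝ, s • e 3 ∈ U →
      fderiv ℝ Φ 0 (e 0) 2 + s * fderiv ℝ Φ 0 (e 1) 2 =
      (fderiv ℝ Φ 0 (e 0) 0 + s * fderiv ℝ Φ 0 (e 1) 0) * Φ (s • e 3) 4 := by
    intro s hs
    rw [← hbase0 0 (by simp) s hs, ← hbase0 2 (by simp) s hs, hbase 0 (by simp) _ hs,
      hbase 2 (by simp) _ hs]
    simp [baseField, e]
  have hT0 : fderiv ℝ Φ 0 (e 0) 0 ≠ 0 := by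
    have h1 := hbase0 0 (by simp) 0 (by simpa using h0U)
    rw [hbase 0 (by simp) _ (by simpa using h0U)] at h1
    simp [baseField, e] at h1
    simp [e, ← h1, hf0, hG0, hH0]
  have hY0t : fderiv ℝ Φ 0 (e 0) 2 = 0 := by
    simpa [hΦ0'] using hrel 0 (by simpa using h0U)
  have hY0x : fderiv ℝ Φ 0 (e 1) 2 = 0 := by
    have h1 : HasDerivAt (fun s : ℝ => s * fderiv ℝ Φ 0 (e 1) 2) (fderiv ℝ Φ 0 (e 1) 2) 0 := by
      simpa using (hasDerivAt_id (0 : ℝ)).mul_const (fderiv ℝ Φ 0 (e 1) 2)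
    have h2 := hasDerivAt_line hd0 (e 3) 4
    simp only [zero_add] at h2
    have h3 := (((hasDerivAt_id (0 : ℝ)).mul_const (fderiv ℝ Φ 0 (e 1) 0)).const_add
      (fderiv ℝ Φ 0 (e 0) 0)).mul h2
    have h4 := h1.unique (h3.congr_of_eventuallyEq (by
      filter_upwards [hmem] with s hs
      simpa [hY0t] using hrel s hs))
    simpa [hY1x, hΦ0'] using h4
  have hY1 : ∀ᶠ s in 𝓝 (0 : ℝ), Φ (s • e 3) 4 = 0 := by
    have hc : ContinuousAt
        (fun s : ℝ => fderiv ℝ Φ 0 (e 0) 0 + s * fderiv ℝ Φ 0 (e 1) 0) 0 := by fun_prop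
    filter_upwards [hmem, hc.eventually_ne (by simpa using hT0)] with s hs hne
    have h1 := hrel s hs
    rw [hY0t, hY0x] at h1
    simpa [hne] using h1.symm
  -- `Y2` vanishes along the `x1`-axis.
  have hfG : ∀ᶠ s in 𝓝 (0 : ℝ), f (s • e 3) * G (s • e 3) ≠ 0 := by
    have hl : ContinuousAt (fun s : ℝ => s • e 3) 0 := by fun_prop
    have h1 : ContinuousAt (fun p => f p * G p) ((0 : ℝ) • e 3) := by
      rw [zero_smul]
      exact (hcf.mul hcG).continuousAt (hU.mem_nhds h0U)
    exact (ContinuousAt.comp (f := fun s : ℝ => s • e 3) h1 hl).eventually_ne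
      (by simp [hf0, hG0])
  have hY2 : ∀ᶠ s in 𝓝 (0 : ℝ), Φ (s • e 3) 6 = 0 := by
    filter_upwards [hmem, hfG, hY1.eventually_nhds] with s hs hne hev
    have h1 := hinner 4 (by simp) (by simp) dep4' _ hs
    have h2 : fderiv ℝ Φ (s • e 3) (innerField (s • e 3)) 4 = fderiv ℝ Φ (s • e 3) (e 3) 4 := by
      refine dep4.fderiv_congr (hdiff _ hs) (hdiff _ hs) (fun _ _ => rfl) fun k hk => ?_
      exact innerField_apply_of_le_four (by simp [e]) (by simp [e]) hk
    have h3 : fderiv ℝ Φ (s • e 3) (e 3) 4 = 0 := by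
      refine fderiv_apply_eq_of_line (hdiff _ hs) (hasDerivAt_const 0 (0 : ℝ)) ?_
      have hc : ContinuousAt (fun u : ℝ => s + u) 0 := by fun_prop
      have := hc.eventually (p := fun u => Φ (u • e 3) 4 = 0) (by simpa using hev)
      simpa [add_smul] using this
    have h4 : innerField (Φ (s • e 3)) 4 = Φ (s • e 3) 6 := by simp [innerField, e]
    rw [h2, h3, h4] at h1
    exact (mul_eq_zero.1 h1.symm).resolve_left hne
  have hY2x1 : fderiv ℝ Φ 0 (e 3) 6 = 0 :=
    fderiv_apply_eq_of_line hd0 (hasDerivAt_const 0 (0 : ℝ)) (by simpa using hY2)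
  have hY2x2 : fderiv ℝ Φ 0 (e 5) 6 = 0 := by
    have h1 := hinner 6 (by simp) (by simp) dep6 0 h0U
    simpa [innerField, hΦ0', e, show fderiv ℝ Φ 0 (Pi.single 3 1) 6 = 0 from hY2x1] using h1
  -- The fibre over the origin of the first seven coordinates.
  have hX2d : ∀ v : E13, fderiv ℝ Φ 0 v 5 = v 5 * H 0 := by
    intro v
    have hHd : DifferentiableAt ℝ H ((0 : ℝ) • v) := by
      simpa using (hHs.contDiffAt (hU.mem_nhds h0U)).differentiableAt (by simp)
    have h1 : HasDerivAt (fun s : ℝ => s • v) v 0 := by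
      simpa using (hasDerivAt_id (0 : ℝ)).smul_const v
    have h2 := ((hasDerivAt_id (0 : ℝ)).mul_const (v 5)).mul
      (hHd.hasFDerivAt.comp_hasDerivAt 0 h1)
    simp at h2
    refine fderiv_apply_eq_of_line hd0 h2 ?_
    filter_upwards [eventually_line_mem hU h0U v] with s hs
    simpa using hX2 _ hs
  have hfib : ∀ p ∈ U, (∀ k : Fin 13, (k : ℕ) ≤ 6 → p k = 0) → ∀ i : Fin 13,
      3 ≤ (i : ℕ) → (i : ℕ) ≤ 6 → DependsUpTo Φ i 6 →
      fderiv ℝ Φ 0 (e 3) i + (1 + p 7) * fderiv ℝ Φ 0 (e 5) i + p 8 * fderiv ℝ Φ 0 (e 6) i =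
        f p * G p * innerField (Φ p) i := by
    intro p hp hp0 i hi3 hi hdep
    have h1 : fderiv ℝ Φ p (innerField p) i =
        fderiv ℝ Φ 0 (e 3 + (1 + p 7) • e 5 + p 8 • e 6) i := by
      refine hdep.fderiv_congr (hdiff p hp) hd0 (by simpa using hp0) fun k hk => ?_
      have h6 := hp0 6 (by simp)
      have h5 := hp0 5 (by simp)
      simp [innerField, h6, h5]
    rw [← hinner i hi3 hi hdep p hp, h1]
    simp
  have hX1e : ∀ k : Fin 13, 5 ≤ (k : ℕ) → fderiv ℝ Φ 0 (e k) 3 = 0 := by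
    intro k hk
    have := dep3.fderiv_congr (v := e k) (w := 0) hd0 hd0 (fun _ _ => rfl) fun l hl => by
      have : l ≠ k := by rintro rfl; omega
      simp [e, this]
    simpa using this
  have hA : ∀ p ∈ U, (∀ k : Fin 13, (k : ℕ) ≤ 6 → p k = 0) →
      f p * G p = fderiv ℝ Φ 0 (e 3) 3 := by
    intro p hp hp0
    have h1 := hfib p hp hp0 3 (by simp) (by simp) dep3'
    rw [hX1e 5 (by simp), hX1e 6 (by simp)] at h1
    simpa [innerField, e] using h1.symm
  have hA0 : fderiv ℝ Φ 0 (e 3) 3 ≠ 0 := by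
    rw [← hA 0 h0U (by simp)]; exact mul_ne_zero hf0 hG0
  set A := fderiv ℝ Φ 0 (e 3) 3
  have hX3' : ∀ p ∈ U, (∀ k : Fin 13, (k : ℕ) ≤ 6 → p k = 0) →
      (1 + p 7) * H 0 = A * (1 + Φ p 7) := by
    intro p hp hp0
    have h1 := hfib p hp hp0 5 (by simp) (by simp) dep5
    rw [hX2d, hX2d, hX2d, hA p hp hp0] at h1
    simpa [innerField, e] using h1
  have hAH : H 0 = A := by simpa [hΦ0'] using hX3' 0 h0U (by simp)
  have hX3 : ∀ p ∈ U, (∀ k : Fin 13, (k : ℕ) ≤ 6 → p k = 0) → Φ p 7 = p 7 := by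
    intro p hp hp0
    have h1 := hX3' p hp hp0
    rw [hAH, mul_comm] at h1
    linear_combination -mul_left_cancel₀ hA0 h1
  obtain ⟨γ, hY3⟩ : ∃ γ : ℝ, ∀ p ∈ U, (∀ k : Fin 13, (k : ℕ) ≤ 6 → p k = 0) →
      Φ p 8 = γ * p 8 := by
    refine ⟨fderiv ℝ Φ 0 (e 6) 6 / A, fun p hp hp0 => ?_⟩
    have h1 := hfib p hp hp0 6 (by simp) (by simp) dep6
    rw [hY2x1, hY2x2, hA p hp hp0] at h1
    have h2 : p 8 * fderiv ℝ Φ 0 (e 6) 6 = A * Φ p 8 := by simpa [innerField, e] using h1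
    field_simp
    linear_combination -h2
  -- The flow of `Z c` preserves this fibre to first order where `x4 = 0`.
  have hZfib : ∀ p : E13, (∀ k : Fin 13, (k : ℕ) ≤ 6 → p k = 0) → p 9 = 0 →
      ∀ s : ℝ, ∀ k : Fin 13, (k : ℕ) ≤ 6 → (p + s • Z c p) k = 0 := by
    intro p hp0 h9 s k hk
    have h1 : Z c p k = 0 := by rw [Z_apply_of_le_six c p hk, h9, zero_mul]
    simp [hp0 k hk, h1]
  have hlin : ∀ a b : ℝ, HasDerivAt (fun s : ℝ => a + s * b) b 0 := fun a b => by
    simpa using ((hasDerivAt_id (0 : ℝ)).mul_const b).const_add a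
  have hf1 : ∀ p ∈ U, (∀ k : Fin 13, (k : ℕ) ≤ 6 → p k = 0) → p 9 = 0 → f p = 1 := by
    intro p hp hp0 h9
    have h1 := hZ p hp 7 (by simp)
    have h2 : fderiv ℝ Φ p (Z c p) 7 = 1 := by
      refine fderiv_apply_eq_of_line (hdiff p hp) (hlin (p 7) 1) ?_
      filter_upwards [eventually_line_mem hU hp (Z c p)] with s hs
      rw [hX3 _ hs (hZfib p hp0 h9 s)]
      simp [Z, e]
    rw [h2] at h1
    simpa [Z, e] using h1.symm
  have hY4' : ∀ p ∈ U, (∀ k : Fin 13, (k : ℕ) ≤ 6 → p k = 0) → p 9 = 0 →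
      1 + Φ p 10 = γ * (1 + p 10) := by
    intro p hp hp0 h9
    have h1 := hZ p hp 8 (by simp)
    have h2 : fderiv ℝ Φ p (Z c p) 8 = γ * (1 + p 10) := by
      refine fderiv_apply_eq_of_line (hdiff p hp) (hlin (γ * p 8) (γ * (1 + p 10))) ?_
      filter_upwards [eventually_line_mem hU hp (Z c p)] with s hs
      rw [hY3 _ hs (hZfib p hp0 h9 s)]
      simp [Z, e]
      ring
    rw [h2, hf1 p hp hp0 h9] at h1
    simpa [Z, e] using h1.symm
  have hγ : γ = 1 := by simpa [hΦ0'] using (hY4' 0 h0U (by simp) rfl).symm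
  have h1 := hZ 0 h0U 10 (by simp)
  have h2 : fderiv ℝ Φ 0 (Z c 0) 10 = c := by
    refine fderiv_apply_eq_of_line hd0 (hlin 0 c) ?_
    filter_upwards [eventually_line_mem hU h0U (Z c 0)] with s hs
    have h3 := hY4' _ hs (hZfib 0 (by simp) rfl s) (by simp [Z, e])
    rw [hγ, one_mul] at h3
    rw [add_left_cancel h3]
    simp [Z, e]
  rw [h2, hf1 0 h0U (by simp) rfl] at h1
  simpa [Z, e, hΦ0'] using h1
end
end

section
/- Under the stated hypotheses on Φ and f, the conjugating factor is normalized at the origin: f(0) = 1. -/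
noncomputable section

/-- `F` depends only on the coordinates of index at most `m`. -/
def DependsOnFirst (F : E13 → ℝ) (m : ℕ) : Prop :=
  ∀ p q : E13, (∀ k : Fin 13, (k : ℕ) ≤ m → p k = q k) → F p = F q

theorem DependsOnFirst.fderiv_eq {F : E13 → ℝ} {m : ℕ} (hF : DependsOnFirst F m) {p q : E13}
    (h : ∀ k : Fin 13, (k : ℕ) ≤ m → p k = q k) : fderiv ℝ F p = fderiv ℝ F q := by
  have hshift : F = fun x => F (x + (q - p)) := by
    funext x
    refine hF _ _ fun k hk => ?_
    simp [h k hk]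
  conv_lhs => rw [hshift]
  rw [fderiv_comp_add_right]
  simp

theorem DependsOnFirst.fderiv_apply_eq_zero {F : E13 → ℝ} {m : ℕ} (hF : DependsOnFirst F m)
    (p : E13) {v : E13} (hv : ∀ k : Fin 13, (k : ℕ) ≤ m → v k = 0) : fderiv ℝ F p v = 0 := by
  by_cases hd : DifferentiableAt ℝ F p
  · rw [← hd.lineDeriv_eq_fderiv, lineDeriv]
    have hconst : (fun t : ℝ => F (p + t • v)) = fun _ => F p := by
      funext t
      refine hF _ _ fun k hk => ?_
      simp [hv k hk]
    rw [hconst, deriv_const]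
  · simp [fderiv_zero_of_not_differentiableAt hd]

/-- Two vectors congruent modulo `span {∂_{x5}, ∂_{y5}}` have the same other coordinates. -/
theorem apply_eq_of_sub_mem_span {v w : E13}
    (h : v - w ∈ Submodule.span ℝ ({e 11, e 12} : Set E13)) {i : Fin 13}
    (h11 : i ≠ 11) (h12 : i ≠ 12) : v i = w i := by
  obtain ⟨a, b, hab⟩ := Submodule.mem_span_pair.1 h
  have := congrFun hab i
  simp [e, h11, h12] at this
  linarith

/-- The differential of `x_i · H` at a point of the hyperplane `x_i = 0`. -/
theorem fderiv_coord_mul_of_eq_zero {F H : E13 → ℝ} {i : Fin 13} {p : E13}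
    (hF : F =ᶠ[nhds p] fun x => x i * H x) (hH : DifferentiableAt ℝ H p) (hp : p i = 0)
    (v : E13) : fderiv ℝ F p v = H p * v i := by
  have hmul := (hasFDerivAt_apply (𝕜 := ℝ) i p).mul hH.hasFDerivAt
  rw [(hmul.congr_of_eventuallyEq hF).fderiv]
  simp [hp]

/-- The point with `x3 = y3 = s`, `x4 = u` and all other coordinates zero. -/
def slicePoint (s u : ℝ) : E13 := s • (e 7 + e 8) + u • e 9

/-- `f(0) = 1`. -/
theorem observation_two_12121 (c c' : ℝ)
    (Φ : E13 → E13) (U : Set E13) (hU : IsOpen U) (h0U : (0 : E13) ∈ U)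
    (hΦsmooth : ContDiffOn ℝ (⊤ : ℕ∞) Φ U) (hΦ0 : Φ 0 = 0)
    (hdiffeo : Function.Bijective (fderiv ℝ Φ 0))
    -- the components `T, X0, Y0` (indices 0,1,2) depend only on `t, x0, y0`
    (htri0 : ∀ p q : E13, (∀ k : Fin 13, (k : ℕ) ≤ 2 → p k = q k) →
      ∀ i : Fin 13, (i : ℕ) ≤ 2 → Φ p i = Φ q i)
    -- for `1 ≤ j ≤ 5`, the components `Xj, Yj` (indices 2j+1, 2j+2)
    -- depend only on `t, x0, y0, x1, y1, ..., xj, yj`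
    (htri : ∀ j : ℕ, 1 ≤ j → j ≤ 5 → ∀ p q : E13,
      (∀ k : Fin 13, (k : ℕ) ≤ 2 * j + 2 → p k = q k) →
      ∀ i : Fin 13, ((i : ℕ) = 2 * j + 1 ∨ (i : ℕ) = 2 * j + 2) → Φ p i = Φ q i)
    (H G : E13 → ℝ)
    (hHs : ContDiffOn ℝ (⊤ : ℕ∞) H U) (hGs : ContDiffOn ℝ (⊤ : ℕ∞) G U)
    (hH0 : H 0 ≠ 0) (hG0 : G 0 ≠ 0)
    -- `X2 = x2·H`, `X4 = x4·G`
    (hX2 : ∀ p ∈ U, Φ p 5 = p 5 * H p)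
    (hX4 : ∀ p ∈ U, Φ p 9 = p 9 * G p)
    (f : E13 → ℝ) (hfs : ContDiffOn ℝ (⊤ : ℕ∞) f U) (hf0 : f 0 ≠ 0)
    -- `dΦ(p)·Z_{1,c}(p) − f(p)·Z_{1,c'}(Φ(p)) ∈ span{∂_{x5}, ∂_{y5}}` near 0
    (hconj : ∀ p ∈ U, fderiv ℝ Φ p (Z c p) - f p • Z c' (Φ p) ∈
      Submodule.span ℝ ({e 11, e 12} : Set E13)) :
    f 0 = 1 := by
  have hdiff : ∀ p ∈ U, DifferentiableAt ℝ Φ p := fun p hp =>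
    (hΦsmooth.contDiffAt (hU.mem_nhds hp)).differentiableAt (by simp)
  have hcomp : ∀ p ∈ U, ∀ v i, fderiv ℝ Φ p v i = fderiv ℝ (fun x => Φ x i) p v := by
    intro p hp v i
    rw [fderiv_apply (hdiff p hp)]
    rfl
  have hconj_apply : ∀ p ∈ U, ∀ i : Fin 13, i ≠ 11 → i ≠ 12 →
      fderiv ℝ (fun x => Φ x i) p (Z c p) = f p * Z c' (Φ p) i := by
    intro p hp i h11 h12
    rw [← hcomp p hp, apply_eq_of_sub_mem_span (hconj p hp) h11 h12]
    rfl
  have hdep3 : DependsOnFirst (fun x => Φ x 3) 4 := fun p q h =>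
    htri 1 (by norm_num) (by norm_num) p q h 3 (by decide)
  have hdep5 : DependsOnFirst (fun x => Φ x 5) 6 := fun p q h =>
    htri 2 (by norm_num) (by norm_num) p q h 5 (by decide)
  have hdep7 : DependsOnFirst (fun x => Φ x 7) 8 := fun p q h =>
    htri 3 (by norm_num) (by norm_num) p q h 7 (by decide)
  have hslice_low : ∀ s u : ℝ, ∀ k : Fin 13, (k : ℕ) ≤ 6 → slicePoint s u k = 0 := by
    intro s u k hk
    fin_cases k <;> simp [slicePoint, e] at hk ⊢
  set a := fderiv ℝ (fun x => Φ x 3) 0 (e 3) with ha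
  have hd5 : ∀ v, fderiv ℝ (fun x => Φ x 5) 0 v = H 0 * v 5 := fun v =>
    fderiv_coord_mul_of_eq_zero
      (Filter.eventually_of_mem (hU.mem_nhds h0U) hX2)
      ((hHs.contDiffAt (hU.mem_nhds h0U)).differentiableAt (by simp)) rfl v
  have hslice : ∀ s u : ℝ, u ≠ 0 → slicePoint s u ∈ U →
      H 0 * (1 + s) = a * (1 + Φ (slicePoint s 0) 7) := by
    intro s u hu hq
    have h3 := hconj_apply _ hq 3 (by decide) (by decide)
    have h5 := hconj_apply _ hq 5 (by decide) (by decide)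
    rw [hdep3.fderiv_eq (q := 0) fun k hk => hslice_low s u k (by omega)] at h3
    rw [hdep5.fderiv_eq (q := 0) fun k hk => hslice_low s u k hk, hd5] at h5
    have hdir : fderiv ℝ (fun x => Φ x 3) 0 (Z c (slicePoint s u)) = u * a := by
      rw [ha, ← smul_eq_mul, ← map_smul, ← sub_eq_zero, ← map_sub]
      refine hdep3.fderiv_apply_eq_zero _ fun k hk => ?_
      fin_cases k <;> simp [Z, slicePoint, e] at hk ⊢
    have h7 : Φ (slicePoint s u) 7 = Φ (slicePoint s 0) 7 := by
      refine hdep7 _ _ fun k hk => ?_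
      fin_cases k <;> simp [slicePoint, e] at hk ⊢
    have hZ3 : ∀ p, Z c' p 3 = p 9 := by intro p; simp [Z, e]
    have hZ5 : ∀ b p, Z b p 5 = p 9 * (1 + p 7) := by intro b p; simp [Z, e]
    rw [hdir, hZ3] at h3
    rw [hZ5, hZ5, h7, ← mul_assoc (f _), ← h3] at h5
    have h9 : slicePoint s u 9 = u := by simp [slicePoint, e]
    have hs7 : slicePoint s u 7 = s := by simp [slicePoint, e]
    rw [h9, hs7] at h5
    apply mul_left_cancel₀ hu
    linear_combination h5
  have hcont : Continuous fun x : ℝ × ℝ => slicePoint x.1 x.2 := by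
    unfold slicePoint; fun_prop
  have hslice_zero : slicePoint 0 0 = 0 := by simp [slicePoint]
  have hmem : ∀ᶠ s in nhds (0 : ℝ), ∃ u : ℝ, u ≠ 0 ∧ slicePoint s u ∈ U := by
    have hnhds : ∀ᶠ x : ℝ × ℝ in nhds (0, 0), slicePoint x.1 x.2 ∈ U :=
      hcont.continuousAt.eventually_mem (by simpa [hslice_zero] using hU.mem_nhds h0U)
    filter_upwards [hnhds.curry_nhds] with s hs
    obtain ⟨u, hu, hu0⟩ := ((hs.filter_mono nhdsWithin_le_nhds).and
      (self_mem_nhdsWithin : {0}ᶜ ∈ nhdsWithin (0 : ℝ) {0}ᶜ)).exists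
    exact ⟨u, hu0, hu⟩
  have hHa : H 0 = a := by
    obtain ⟨u, hu, hq⟩ := hmem.self_of_nhds
    simpa [hslice_zero, hΦ0] using hslice 0 u hu hq
  have hX3 : (fun s : ℝ => Φ (0 + s • (e 7 + e 8)) 7) =ᶠ[nhds 0] fun s => s := by
    filter_upwards [hmem] with s ⟨u, hu, hq⟩
    have h := hslice s u hu hq
    rw [← hHa] at h
    have h' := mul_left_cancel₀ hH0 h
    simp only [slicePoint, zero_smul, add_zero] at h'
    rw [zero_add]
    linarith
  have hd7 : fderiv ℝ (fun x => Φ x 7) 0 (e 7 + e 8) = 1 := by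
    have hdiff7 : DifferentiableAt ℝ (fun x => Φ x 7) 0 := differentiableAt_pi.1 (hdiff 0 h0U) 7
    rw [← hdiff7.lineDeriv_eq_fderiv, lineDeriv, hX3.deriv_eq]
    exact deriv_id 0
  have hf := hconj_apply 0 h0U 7 (by decide) (by decide)
  have hZ0 : fderiv ℝ (fun x => Φ x 7) 0 (Z c 0) = fderiv ℝ (fun x => Φ x 7) 0 (e 7 + e 8) := by
    rw [← sub_eq_zero, ← map_sub]
    refine hdep7.fderiv_apply_eq_zero _ fun k hk => ?_
    fin_cases k <;> simp [Z, e] at hk ⊢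
  have hZ7 : ∀ p, Z c' p 7 = 1 := by intro p; simp [Z, e]
  rw [hZ0, hd7, hZ7, mul_one] at hf
  exact hf.symm
end
end
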